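/- arXiv:1201.5173 — 2 statements merged into one kernel-verified Lean document; each statement's English description precedes it below -/
import Mathlib

section
/- Let τ, q ∈ ℕ, let ω₁, …, ω_q be real weights, let G₁, …, G_q be independent geometric random variables with parameters p₁, …, p_q ∈ (0,1], and suppose ω_d p_d < ω_{d+1} p_{d+1} for some d ∈ {1,…,q−1}. Let ω′_i = ω_i for i ∉ {d, d+1}, ω′_d = ω_{d+1}, ω′_{d+1} = ω_d, and let G′₁, …, G′_q be independent geometric random variables (independent of the G_i's) with parameters p₁, …, p_{d−1}, p_{d+1}, p_d, p_{d+2}, …, p_q. Then Σ_{i=1}^{q} ω_i · Pr(G₁ + ⋯ + G_i ≤ τ) ≤ Σ_{i=1}^{q} ω′_i · Pr(G′₁ + ⋯ + G′_i ≤ τ). -/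
open Finset

/-- `probSumLe p n τ` is the probability that `G₁ + ⋯ + G_n ≤ τ`, where
`G₁, …, G_n` are independent geometric random variables taking values in
`{1, 2, 3, …}` with `Pr(G_i = k) = p (i-1) * (1 - p (i-1)) ^ (k - 1)`
(i.e. with parameters `p 0, …, p (n-1)`).  It is computed by summing the joint
probability mass over all tuples of values `(k 0, …, k (n-1))`, each in
`{1, …, τ}`, whose total is at most `τ`. -/
noncomputable def probSumLe (p : ℕ → ℝ) (n τ : ℕ) : ℝ :=
  ∑ k ∈ (Fintype.piFinset fun _ : Fin n => Finset.Icc 1 τ).filter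
      (fun k => ∑ j, k j ≤ τ),
    ∏ j : Fin n, p j * (1 - p j) ^ (k j - 1)

theorem probSumLe_zero (p : ℕ → ℝ) (τ : ℕ) : probSumLe p 0 τ = 1 := by
  simp [probSumLe]

theorem probSumLe_succ_eq_sum (p : ℕ → ℝ) (n τ : ℕ) :
    probSumLe p (n + 1) τ =
      ∑ k ∈ Finset.range τ, p n * (1 - p n) ^ k * probSumLe p n (τ - 1 - k) := by
  simp only [probSumLe, Finset.mul_sum]
  rw [Finset.sum_sigma']
  refine Finset.sum_bij' (fun x _ => ⟨x (Fin.last n) - 1, Fin.init x⟩)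
    (fun y _ => Fin.snoc (α := fun _ => ℕ) y.2 (y.1 + 1)) ?_ ?_ ?_ ?_ ?_
  · intro x hx
    simp only [Finset.mem_filter, Fintype.mem_piFinset, Finset.mem_Icc, Finset.mem_sigma,
      Finset.mem_range, Fin.sum_univ_castSucc] at hx ⊢
    obtain ⟨hx, hsum⟩ := hx
    have hl := hx (Fin.last n)
    have hinit : ∑ j, Fin.init (α := fun _ => ℕ) x j ≤ τ - 1 - (x (Fin.last n) - 1) := by
      simp only [Fin.init]
      omega
    refine ⟨by omega, fun j => ⟨(hx j.castSucc).1, ?_⟩, hinit⟩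
    exact (Finset.single_le_sum (f := Fin.init (α := fun _ => ℕ) x)
      (fun _ _ => Nat.zero_le _) (Finset.mem_univ j)).trans hinit
  · rintro ⟨k, y⟩ hy
    simp only [Finset.mem_filter, Fintype.mem_piFinset, Finset.mem_Icc, Finset.mem_sigma,
      Finset.mem_range, Fin.sum_univ_castSucc, Fin.forall_fin_succ', Fin.snoc_castSucc,
      Fin.snoc_last] at hy ⊢
    obtain ⟨hk, hy, hsum⟩ := hy
    refine ⟨⟨fun j => ⟨(hy j).1, ?_⟩, by omega⟩, by omega⟩
    have := (hy j).2
    omega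
  · intro x hx
    simp only [Finset.mem_filter, Fintype.mem_piFinset, Finset.mem_Icc] at hx
    have hl := (hx.1 (Fin.last n)).1
    simp only [Nat.sub_add_cancel hl]
    exact Fin.snoc_init_self x
  · rintro ⟨k, y⟩ hy
    simp
  · intro x hx
    simp [Fin.prod_univ_castSucc, Fin.init, mul_comm]

theorem probSumLe_succ_zero (p : ℕ → ℝ) (n : ℕ) : probSumLe p (n + 1) 0 = 0 := by
  simp [probSumLe_succ_eq_sum]

theorem probSumLe_succ_succ (p : ℕ → ℝ) (n τ : ℕ) :
    probSumLe p (n + 1) (τ + 1) =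
      p n * probSumLe p n τ + (1 - p n) * probSumLe p (n + 1) τ := by
  rw [probSumLe_succ_eq_sum, probSumLe_succ_eq_sum p n τ, Finset.sum_range_succ', add_comm,
    Finset.mul_sum]
  congr 1
  · simp
  · refine Finset.sum_congr rfl fun k _ => ?_
    rw [show τ + 1 - 1 - (k + 1) = τ - 1 - k by omega]
    ring

theorem probSumLe_congr {p p' : ℕ → ℝ} {n : ℕ} (h : ∀ i < n, p i = p' i) :
    probSumLe p n = probSumLe p' n := by
  funext τ
  refine Finset.sum_congr rfl fun k _ => Finset.prod_congr rfl fun j _ => ?_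
  rw [h j j.isLt]

theorem probSumLe_congr_of_le {p p' : ℕ → ℝ} {m n : ℕ} (hmn : m ≤ n)
    (hm : probSumLe p m = probSumLe p' m) (h : ∀ i, m ≤ i → p i = p' i) :
    probSumLe p n = probSumLe p' n := by
  induction n, hmn using Nat.le_induction with
  | base => exact hm
  | succ n hmn ih =>
    funext τ
    simp only [probSumLe_succ_eq_sum, ih, h n hmn]

theorem probSumLe_succ_le_of_monotone {p : ℕ → ℝ} {n : ℕ} (h1 : p n ≤ 1)
    (hnonneg : 0 ≤ probSumLe p n 0) (hmono : Monotone (probSumLe p n)) (τ : ℕ) :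
    probSumLe p (n + 1) τ ≤ probSumLe p n τ := by
  induction τ with
  | zero => rwa [probSumLe_succ_zero]
  | succ τ ih =>
    rw [probSumLe_succ_succ]
    have := hmono (Nat.le_succ τ)
    nlinarith [mul_le_mul_of_nonneg_left ih (sub_nonneg.2 h1)]

theorem probSumLe_zero_right_nonneg (p : ℕ → ℝ) (n : ℕ) : 0 ≤ probSumLe p n 0 := by
  cases n with
  | zero => simp [probSumLe_zero]
  | succ n => rw [probSumLe_succ_zero]

theorem monotone_probSumLe {p : ℕ → ℝ} {n : ℕ} (h0 : ∀ i < n, 0 ≤ p i)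
    (h1 : ∀ i < n, p i ≤ 1) : Monotone (probSumLe p n) := by
  induction n with
  | zero => exact fun _ _ _ => by simp [probSumLe_zero]
  | succ n ih =>
    refine monotone_nat_of_le_succ fun τ => ?_
    have hle := probSumLe_succ_le_of_monotone (h1 n n.lt_succ_self)
      (probSumLe_zero_right_nonneg p n)
      (ih (fun i hi => h0 i (hi.trans n.lt_succ_self)) fun i hi => h1 i (hi.trans n.lt_succ_self)) τ
    rw [probSumLe_succ_succ]
    nlinarith [mul_nonneg (h0 n n.lt_succ_self) (sub_nonneg.2 hle)]

theorem probSumLe_succ_le {p : ℕ → ℝ} {n : ℕ} (h0 : ∀ i ≤ n, 0 ≤ p i)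
    (h1 : ∀ i ≤ n, p i ≤ 1) (τ : ℕ) : probSumLe p (n + 1) τ ≤ probSumLe p n τ :=
  probSumLe_succ_le_of_monotone (h1 n le_rfl) (probSumLe_zero_right_nonneg p n)
    (monotone_probSumLe (fun i hi => h0 i hi.le) fun i hi => h1 i hi.le) τ

/-- Exchanging the parameters at positions `d` and `d + 1` preserves the law of the sum of the
first `d + 2` variables, and the probabilities that the budget `τ` is exhausted exactly by the
last of these variables are in the ratio of the parameters. -/
theorem probSumLe_swap {p p' : ℕ → ℝ} {d : ℕ} (hlt : ∀ i < d, p' i = p i)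
    (hd : p' d = p (d + 1)) (hd' : p' (d + 1) = p d) (τ : ℕ) :
    probSumLe p' (d + 2) τ = probSumLe p (d + 2) τ ∧
      p (d + 1) * (probSumLe p (d + 1) τ - probSumLe p (d + 2) τ) =
        p d * (probSumLe p' (d + 1) τ - probSumLe p (d + 2) τ) := by
  induction τ with
  | zero => simp [probSumLe_succ_zero]
  | succ τ ih =>
    obtain ⟨heq, hratio⟩ := ih
    rw [probSumLe_succ_succ p' (d + 1), probSumLe_succ_succ p (d + 1), probSumLe_succ_succ p' d,
      probSumLe_succ_succ p d, probSumLe_congr hlt, hd, hd', heq]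
    constructor
    · linear_combination -hratio
    · linear_combination (1 - p (d + 1)) * hratio

/-- weighted adjacent-swap lemma: if `ω_d·p_d < ω_{d+1}·p_{d+1}`
then swapping positions `d` and `d+1` (both weights and parameters) does not
decrease the expected weighted reward
`Σ_{i=1}^{q} ω_i · Pr(G₁ + ⋯ + G_i ≤ τ)`.  Positions are 0-indexed, so the
paper's `d ∈ {1, …, q-1}` becomes `d + 1 < q`. -/
theorem stmt12 (τ q : ℕ) (p ω : ℕ → ℝ)
    (hp_pos : ∀ i < q, 0 < p i) (hp_le : ∀ i < q, p i ≤ 1)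
    (d : ℕ) (hd : d + 1 < q) (hswap : ω d * p d < ω (d + 1) * p (d + 1)) :
    ∑ i ∈ Finset.range q, ω i * probSumLe p (i + 1) τ ≤
      ∑ i ∈ Finset.range q,
        (if i = d then ω (d + 1) else if i = d + 1 then ω d else ω i) *
          probSumLe (fun j => if j = d then p (d + 1) else
            if j = d + 1 then p d else p j) (i + 1) τ := by
  set p' : ℕ → ℝ := fun j => if j = d then p (d + 1) else if j = d + 1 then p d else p j with hp'
  have hlt : ∀ i < d, p' i = p i := fun i hi => by
    simp [hp', hi.ne, (hi.trans d.lt_succ_self).ne]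
  have hgt : ∀ i, d + 2 ≤ i → p' i = p i := fun i hi => by
    simp [hp', show i ≠ d by omega, show i ≠ d + 1 by omega]
  have hd₀ : p' d = p (d + 1) := by simp [hp']
  have hd₁ : p' (d + 1) = p d := by simp [hp']
  obtain ⟨heq, hratio⟩ := probSumLe_swap hlt hd₀ hd₁ τ
  have hpos := hp_pos (d + 1) hd
  have hpos' := hp_pos d (by omega)
  have hle : probSumLe p (d + 2) τ ≤ probSumLe p (d + 1) τ :=
    probSumLe_succ_le (fun i hi => (hp_pos i (by omega)).le) (fun i hi => hp_le i (by omega)) τ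
  have hle' : 0 ≤ probSumLe p' (d + 1) τ - probSumLe p (d + 2) τ :=
    nonneg_of_mul_nonneg_right (hratio ▸ mul_nonneg hpos.le (sub_nonneg.2 hle)) hpos'
  have hpair : 0 ≤ ω (d + 1) * (probSumLe p' (d + 1) τ - probSumLe p (d + 2) τ) -
      ω d * (probSumLe p (d + 1) τ - probSumLe p (d + 2) τ) := by
    refine nonneg_of_mul_nonneg_right (a := p (d + 1)) ?_ hpos
    have := mul_nonneg (sub_nonneg.2 hswap.le) hle'
    linear_combination this + ω d * hratio
  obtain ⟨r, rfl⟩ := Nat.exists_eq_add_of_le (show d + 2 ≤ q from hd)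
  simp only [Finset.sum_range_add, Finset.sum_range_succ _ (d + 1), Finset.sum_range_succ _ d]
  have hhead : ∑ i ∈ Finset.range d, (if i = d then ω (d + 1) else if i = d + 1 then ω d else ω i) *
      probSumLe p' (i + 1) τ = ∑ i ∈ Finset.range d, ω i * probSumLe p (i + 1) τ := by
    refine Finset.sum_congr rfl fun i hi => ?_
    have hi := Finset.mem_range.1 hi
    rw [if_neg (by omega), if_neg (by omega),
      probSumLe_congr fun j (hj : j < i + 1) => hlt j (by omega)]
  have htail : ∑ i ∈ Finset.range r, (if d + 2 + i = d then ω (d + 1) else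
      if d + 2 + i = d + 1 then ω d else ω (d + 2 + i)) * probSumLe p' (d + 2 + i + 1) τ =
      ∑ i ∈ Finset.range r, ω (d + 2 + i) * probSumLe p (d + 2 + i + 1) τ := by
    refine Finset.sum_congr rfl fun i _ => ?_
    rw [if_neg (by omega), if_neg (by omega), probSumLe_congr_of_le (by omega)
      (funext fun τ => (probSumLe_swap hlt hd₀ hd₁ τ).1) hgt]
  rw [hhead, htail, heq]
  simp only [if_true, if_neg d.succ_ne_self]
  linarith
end

section
/- Let τ ∈ ℕ, let ω₁, …, ω_q be real weights with ω_i ≥ 1, and let G₁, …, G_q be independent geometric random variables with parameters p₁, …, p_q ∈ (0,1] satisfying ω₁ p₁ ≥ ω₂ p₂ ≥ … ≥ ω_q p_q. Then for every permutation π of {1, 2, …, q}, Σ_{i=1}^{q} ω_{π(i)} · Pr(G_{π(1)} + ⋯ + G_{π(i)} ≤ τ) ≤ Σ_{i=1}^{q} ω_i · Pr(G₁ + ⋯ + G_i ≤ τ); that is, serving clients in decreasing order of the products ω_j p_j maximizes the expected weighted reward within τ time-slots over all serving orders. -/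
open Finset

/-- The power series `∑ x ^ k X ^ k`. -/
noncomputable def geomSeries (x : ℝ) : PowerSeries ℝ := PowerSeries.mk fun k => x ^ k

/-- The generating function of a geometric random variable with parameter `p`. -/
noncomputable def geomPGF (p : ℝ) : PowerSeries ℝ :=
  PowerSeries.X * (PowerSeries.C p * geomSeries (1 - p))

/-- The generating function, in the number of time-slots, of the expected reward obtained by serving
the clients in the order given by a list. -/
noncomputable def rewardSeries (p ω : ℕ → ℝ) : List ℕ → PowerSeries ℝ
  | [] => 0
  | a :: l => geomPGF (p a) * (PowerSeries.C (ω a) * geomSeries 1 + rewardSeries p ω l)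

lemma geomSeries_eq (x : ℝ) :
    geomSeries x = 1 + PowerSeries.C x * (PowerSeries.X * geomSeries x) := by
  ext n
  rcases n with _ | n
  · simp [geomSeries]
  · simp [geomSeries, PowerSeries.coeff_succ_X_mul, PowerSeries.coeff_one, pow_succ']

lemma one_sub_geomPGF_mul_geomSeries_one (p : ℝ) :
    (1 - geomPGF p) * geomSeries 1 = geomSeries (1 - p) := by
  have h₁ := geomSeries_eq 1
  have h₂ := geomSeries_eq (1 - p)
  simp only [map_one, map_sub] at h₁ h₂
  rw [geomPGF]
  linear_combination geomSeries (1 - p) * h₁ - geomSeries 1 * h₂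

lemma coeff_mul_nonneg {F G : PowerSeries ℝ} (hF : ∀ n, 0 ≤ F.coeff n)
    (hG : ∀ n, 0 ≤ G.coeff n) (n : ℕ) : 0 ≤ (F * G).coeff n := by
  rw [PowerSeries.coeff_mul]
  exact Finset.sum_nonneg fun _ _ => mul_nonneg (hF _) (hG _)

lemma coeff_X_nonneg (n : ℕ) : 0 ≤ (PowerSeries.X : PowerSeries ℝ).coeff n := by
  rw [PowerSeries.coeff_X]
  split_ifs <;> simp

lemma coeff_geomSeries_nonneg {x : ℝ} (hx : 0 ≤ x) (n : ℕ) : 0 ≤ (geomSeries x).coeff n := by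
  simpa [geomSeries] using pow_nonneg hx n

lemma coeff_geomPGF_nonneg {p : ℝ} (h₀ : 0 ≤ p) (h₁ : p ≤ 1) (n : ℕ) :
    0 ≤ (geomPGF p).coeff n := by
  refine coeff_mul_nonneg coeff_X_nonneg (fun m => ?_) n
  rw [PowerSeries.coeff_C_mul]
  exact mul_nonneg h₀ (coeff_geomSeries_nonneg (by linarith) m)

lemma rewardSeries_swap (p ω : ℕ → ℝ) (a b : ℕ) (l : List ℕ) :
    rewardSeries p ω (a :: b :: l) - rewardSeries p ω (b :: a :: l) =
      PowerSeries.C (ω a * p a - ω b * p b) *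
        (PowerSeries.X * (geomSeries (1 - p a) * geomSeries (1 - p b))) := by
  have ha := one_sub_geomPGF_mul_geomSeries_one (p a)
  have hb := one_sub_geomPGF_mul_geomSeries_one (p b)
  have ea : geomPGF (p a) = PowerSeries.X * (PowerSeries.C (p a) * geomSeries (1 - p a)) := rfl
  have eb : geomPGF (p b) = PowerSeries.X * (PowerSeries.C (p b) * geomSeries (1 - p b)) := rfl
  simp only [rewardSeries, map_sub, map_mul]
  linear_combination PowerSeries.C (ω a) * geomPGF (p a) * hb
    - PowerSeries.C (ω b) * geomPGF (p b) * ha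
    + PowerSeries.C (ω a) * geomSeries (1 - p b) * ea
    - PowerSeries.C (ω b) * geomSeries (1 - p a) * eb

lemma coeff_rewardSeries_cons_mono {p : ℕ → ℝ} (ω : ℕ → ℝ) {a : ℕ} (h₀ : 0 ≤ p a)
    (h₁ : p a ≤ 1) {l l' : List ℕ}
    (h : ∀ n, (rewardSeries p ω l).coeff n ≤ (rewardSeries p ω l').coeff n) (n : ℕ) :
    (rewardSeries p ω (a :: l)).coeff n ≤ (rewardSeries p ω (a :: l')).coeff n := by
  have := coeff_mul_nonneg (G := rewardSeries p ω l' - rewardSeries p ω l)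
    (coeff_geomPGF_nonneg h₀ h₁) (fun m => by simpa using h m) n
  rw [mul_sub, map_sub] at this
  simp only [rewardSeries, mul_add, map_add]
  linarith

section Order

variable {p ω : ℕ → ℝ} {q : ℕ}

lemma coeff_rewardSeries_le_orderedInsert (hp_pos : ∀ i < q, 0 < p i) (hp_le : ∀ i < q, p i ≤ 1)
    (hanti : ∀ i j, i ≤ j → j < q → ω j * p j ≤ ω i * p i) {a : ℕ} (ha : a < q) :
    ∀ l : List ℕ, (∀ b ∈ l, b < q) → ∀ n, (rewardSeries p ω (a :: l)).coeff n ≤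
      (rewardSeries p ω (l.orderedInsert (· ≤ ·) a)).coeff n
  | [], _, _ => le_rfl
  | b :: l, hl, n => by
    have hb : b < q := hl b (by simp)
    rw [List.orderedInsert]
    split_ifs with hab
    · exact le_rfl
    · refine le_trans ?_ (coeff_rewardSeries_cons_mono ω (hp_pos b hb).le (hp_le b hb)
        (coeff_rewardSeries_le_orderedInsert hp_pos hp_le hanti ha l
          fun c hc => hl c (by simp [hc])) n)
      rw [← sub_nonneg, ← map_sub, rewardSeries_swap, PowerSeries.coeff_C_mul]
      refine mul_nonneg (sub_nonneg.2 (hanti b a (by omega) ha)) ?_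
      exact coeff_mul_nonneg coeff_X_nonneg (coeff_mul_nonneg
        (coeff_geomSeries_nonneg (by linarith [hp_le b hb]))
        (coeff_geomSeries_nonneg (by linarith [hp_le a ha]))) n

lemma coeff_rewardSeries_le_insertionSort (hp_pos : ∀ i < q, 0 < p i) (hp_le : ∀ i < q, p i ≤ 1)
    (hanti : ∀ i j, i ≤ j → j < q → ω j * p j ≤ ω i * p i) :
    ∀ l : List ℕ, (∀ b ∈ l, b < q) → ∀ n, (rewardSeries p ω l).coeff n ≤
      (rewardSeries p ω (l.insertionSort (· ≤ ·))).coeff n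
  | [], _, _ => le_rfl
  | a :: l, hl, n => by
    have ha : a < q := hl a (by simp)
    have hl' : ∀ b ∈ l, b < q := fun b hb => hl b (by simp [hb])
    rw [List.insertionSort_cons]
    exact (coeff_rewardSeries_cons_mono ω (hp_pos a ha).le (hp_le a ha)
      (coeff_rewardSeries_le_insertionSort hp_pos hp_le hanti l hl') n).trans
      (coeff_rewardSeries_le_orderedInsert hp_pos hp_le hanti ha _
        (fun b hb => hl' b ((List.mem_insertionSort _).1 hb)) n)

end Order

lemma probSumLe_succ (p : ℕ → ℝ) (n τ : ℕ) :
    probSumLe p (n + 1) τ = ∑ k ∈ Finset.Icc 1 τ,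
      p 0 * (1 - p 0) ^ (k - 1) * probSumLe (fun j => p (j + 1)) n (τ - k) := by
  simp only [probSumLe, Finset.mul_sum]
  rw [Finset.sum_sigma']
  refine Finset.sum_bij' (fun k _ => ⟨k 0, Fin.tail k⟩) (fun k _ => Fin.cons k.1 k.2)
    ?_ ?_ ?_ ?_ ?_
  · intro k hk
    simp only [Finset.mem_filter, Fintype.mem_piFinset, Finset.mem_Icc, Finset.mem_sigma,
      Fin.sum_univ_succ, Fin.tail] at hk ⊢
    refine ⟨hk.1 0, fun j => ⟨(hk.1 j.succ).1, ?_⟩, by omega⟩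
    have := Finset.single_le_sum (f := fun j : Fin n => k j.succ) (fun _ _ => Nat.zero_le _)
      (Finset.mem_univ j)
    omega
  · intro k hk
    simp only [Finset.mem_filter, Fintype.mem_piFinset, Finset.mem_Icc, Finset.mem_sigma,
      Fin.sum_univ_succ, Fin.cons_zero, Fin.cons_succ, Fin.forall_fin_succ] at hk ⊢
    exact ⟨⟨hk.1, fun j => ⟨(hk.2.1 j).1, by have := (hk.2.1 j).2; omega⟩⟩, by omega⟩
  · intro k _
    exact Fin.cons_self_tail k
  · intro k _
    simp
  · intro k _
    simp [Fin.prod_univ_succ, Fin.tail]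

lemma coeff_geomPGF_mul (p : ℝ) (F : PowerSeries ℝ) (τ : ℕ) :
    (geomPGF p * F).coeff τ =
      ∑ k ∈ Finset.Icc 1 τ, p * (1 - p) ^ (k - 1) * F.coeff (τ - k) := by
  rcases τ with _ | τ
  · simp [geomPGF]
  · rw [geomPGF, mul_assoc, PowerSeries.coeff_succ_X_mul, PowerSeries.coeff_mul,
      Finset.Nat.sum_antidiagonal_eq_sum_range_succ_mk, ← Finset.Ico_add_one_right_eq_Icc,
      Finset.sum_Ico_eq_sum_range]
    refine Finset.sum_congr (by simp) fun k _ => ?_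
    rw [PowerSeries.coeff_C_mul, geomSeries, PowerSeries.coeff_mk,
      show τ + 1 - (1 + k) = τ - k by omega, Nat.add_sub_cancel_left]

lemma probSumLe_eq_coeff (p : ℕ → ℝ) (n τ : ℕ) :
    probSumLe p n τ = ((∏ j ∈ Finset.range n, geomPGF (p j)) * geomSeries 1).coeff τ := by
  induction n generalizing p τ with
  | zero => simp [probSumLe, geomSeries]
  | succ n ih =>
    rw [probSumLe_succ, Finset.prod_range_succ', mul_comm (∏ _ ∈ _, _), mul_assoc,
      coeff_geomPGF_mul]
    exact Finset.sum_congr rfl fun k _ => by rw [ih]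

lemma rewardSeries_map_range (p ω : ℕ → ℝ) (σ : ℕ → ℕ) (q : ℕ) :
    rewardSeries p ω ((List.range q).map σ) = ∑ i ∈ Finset.range q, PowerSeries.C (ω (σ i)) *
      ((∏ j ∈ Finset.range (i + 1), geomPGF (p (σ j))) * geomSeries 1) := by
  induction q generalizing σ with
  | zero => simp [rewardSeries]
  | succ q ih =>
    rw [List.range_succ_eq_map, List.map_cons, List.map_map, rewardSeries, ih,
      Finset.sum_range_succ', mul_add, Finset.mul_sum, add_comm]
    congr 1
    · refine Finset.sum_congr rfl fun i _ => ?_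
      rw [Finset.prod_range_succ' _ (i + 1)]
      simp only [Function.comp_apply, Nat.succ_eq_add_one]
      ring
    · simp only [zero_add, Finset.prod_range_one]
      ring

lemma sum_mul_probSumLe_eq_coeff (p ω : ℕ → ℝ) (σ : ℕ → ℕ) (q τ : ℕ) :
    ∑ i ∈ Finset.range q, ω (σ i) * probSumLe (fun j => p (σ j)) (i + 1) τ =
      (rewardSeries p ω ((List.range q).map σ)).coeff τ := by
  simp only [rewardSeries_map_range, map_sum, PowerSeries.coeff_C_mul, probSumLe_eq_coeff]

lemma map_range_perm_range {q : ℕ} (π : Equiv.Perm ℕ) (hπ : ∀ i < q, π i < q) :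
    ((List.range q).map π).Perm (List.range q) := by
  refine (List.Nodup.subperm (List.nodup_range.map π.injective) fun x hx => ?_).perm_of_length_le
    (by simp)
  obtain ⟨i, hi, rfl⟩ := List.mem_map.1 hx
  exact List.mem_range.2 (hπ i (List.mem_range.1 hi))

/-- with weights `ω_i ≥ 1` and parameters `p_i ∈ (0,1]` ordered
so that `ω₁p₁ ≥ ω₂p₂ ≥ ⋯ ≥ ω_q p_q`, for every permutation `π` of `{1, …, q}`
(formalized as a permutation of `ℕ` mapping `{0, …, q-1}` into itself):
`Σ_{i=1}^{q} ω_{π(i)}·Pr(G_{π(1)} + ⋯ + G_{π(i)} ≤ τ)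
  ≤ Σ_{i=1}^{q} ω_i·Pr(G₁ + ⋯ + G_i ≤ τ)`. -/
theorem stmt15 (τ q : ℕ) (p ω : ℕ → ℝ)
    (hω : ∀ i < q, 1 ≤ ω i)
    (hp_pos : ∀ i < q, 0 < p i) (hp_le : ∀ i < q, p i ≤ 1)
    (hmono : ∀ i, i + 1 < q → ω (i + 1) * p (i + 1) ≤ ω i * p i)
    (π : Equiv.Perm ℕ) (hπ : ∀ i < q, π i < q) :
    ∑ i ∈ Finset.range q, ω (π i) * probSumLe (fun j => p (π j)) (i + 1) τ ≤
      ∑ i ∈ Finset.range q, ω i * probSumLe p (i + 1) τ := by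
  have hanti : ∀ i j, i ≤ j → j < q → ω j * p j ≤ ω i * p i := by
    intro i j hij
    induction j, hij using Nat.le_induction with
    | base => exact fun _ => le_rfl
    | succ j _ ih => exact fun hj => (hmono j hj).trans (ih (by omega))
  have hsort : ((List.range q).map π).insertionSort (· ≤ ·) = (List.range q).map id := by
    rw [List.map_id]
    exact ((List.perm_insertionSort _ _).trans (map_range_perm_range π hπ)).eq_of_pairwise'
      (List.pairwise_insertionSort _ _) List.pairwise_le_range
  have h := coeff_rewardSeries_le_insertionSort hp_pos hp_le hanti ((List.range q).map π)
    (fun b hb => List.mem_range.1 ((map_range_perm_range π hπ).mem_iff.1 hb)) τ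
  rw [hsort, ← sum_mul_probSumLe_eq_coeff, ← sum_mul_probSumLe_eq_coeff] at h
  exact h
end
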